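/- arXiv:1204.1534 — 5 statements merged into one kernel-verified Lean document; each statement's English description precedes it below -/
import Mathlib

section
/- Let k be a field, let W be a vector space over k, and let X_1, …, X_N be subspaces of W. Then the following are equivalent: (1) the collection X_1, …, X_N is distributive in W; (2) there exists an index set H and a family of subspaces (W_η)_{η ∈ H} of W forming an internal direct sum decomposition W = ⨁_{η ∈ H} W_η, such that for every i ∈ {1, …, N} there is a subset H_i ⊆ H with X_i = ⨁_{η ∈ H_i} W_η. -/
/-- A collection of subspaces of a vector space `W` is *distributive* if the sublattice of the
lattice of all subspaces of `W` generated by the collection (under intersection and sum) is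
distributive, i.e. `a ⊓ (b ⊔ c) = (a ⊓ b) ⊔ (a ⊓ c)` for all `a, b, c` in the generated
sublattice. -/
def IsDistributiveCollection {k W : Type*} [Field k] [AddCommGroup W] [Module k W]
    (S : Set (Submodule k W)) : Prop :=
  ∀ a ∈ latticeClosure S, ∀ b ∈ latticeClosure S, ∀ c ∈ latticeClosure S,
    a ⊓ (b ⊔ c) = (a ⊓ b) ⊔ (a ⊓ c)

theorem aux_inf_biSup {k W H : Type*} [Field k] [AddCommGroup W] [Module k W]
    (F : H → Submodule k W) (hF : iSupIndep F) (A B : Set H) :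
    (⨆ i ∈ A, F i) ⊓ (⨆ i ∈ B, F i) = ⨆ i ∈ A ∩ B, F i := by
  have h1 : (⨆ i ∈ A, F i) = (⨆ i ∈ A ∩ B, F i) ⊔ (⨆ i ∈ A \ B, F i) := by
    rw [← iSup_union, Set.inter_union_sdiff]
  have h2 : (⨆ i ∈ A ∩ B, F i) ≤ (⨆ i ∈ B, F i) := biSup_mono fun i hi => hi.2
  rw [h1, sup_inf_assoc_of_le _ h2, (hF.disjoint_biSup_biSup Set.disjoint_sdiff_left).eq_bot,
    sup_bot_eq]

theorem aux_backward {k W H : Type*} [Field k] [AddCommGroup W] [Module k W]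
    (F : H → Submodule k W) (hF : iSupIndep F) (S : Set (Submodule k W))
    (hS : ∀ x ∈ S, ∃ A : Set H, x = ⨆ i ∈ A, F i) : IsDistributiveCollection S := by
  have key : latticeClosure S ⊆ {x | ∃ A : Set H, x = ⨆ i ∈ A, F i} := by
    refine latticeClosure_min hS ⟨?_, ?_⟩
    · rintro _ ⟨A, rfl⟩ _ ⟨B, rfl⟩
      exact ⟨A ∪ B, iSup_union.symm⟩
    · rintro _ ⟨A, rfl⟩ _ ⟨B, rfl⟩
      exact ⟨A ∩ B, aux_inf_biSup F hF A B⟩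
  intro a ha b hb c hc
  obtain ⟨A, rfl⟩ := key ha
  obtain ⟨B, rfl⟩ := key hb
  obtain ⟨C, rfl⟩ := key hc
  rw [← iSup_union, aux_inf_biSup F hF, aux_inf_biSup F hF, aux_inf_biSup F hF, ← iSup_union,
    Set.inter_union_distrib_left]

theorem aux_inf_sup {k W ι : Type*} [Field k] [AddCommGroup W] [Module k W]
    (X : ι → Submodule k W) (h : IsDistributiveCollection (Set.range X))
    (a : Submodule k W) (ha : a ∈ latticeClosure (Set.range X)) (T : Finset ι) :
    (a ⊓ T.sup X = T.sup fun i => a ⊓ X i) ∧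
      (T.Nonempty → T.sup X ∈ latticeClosure (Set.range X)) := by
  classical
  have hX : ∀ i, X i ∈ latticeClosure (Set.range X) := fun i => subset_latticeClosure ⟨i, rfl⟩
  induction T using Finset.induction_on with
  | empty => simp
  | insert i T hi ih =>
    rcases T.eq_empty_or_nonempty with rfl | hT
    · simp [hX]
    · rw [Finset.sup_insert, Finset.sup_insert, h a ha _ (hX i) _ (ih.2 hT), ih.1]
      exact ⟨rfl, fun _ => isSublattice_latticeClosure.supClosed (hX i) (ih.2 hT)⟩

theorem aux_inf_mem {k W ι : Type*} [Field k] [AddCommGroup W] [Module k W]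
    (X : ι → Submodule k W) (T : Finset ι) (hT : T.Nonempty) :
    T.inf X ∈ latticeClosure (Set.range X) := by
  rw [← Finset.inf'_eq_inf hT]
  exact Finset.inf'_induction _ _
    (fun a ha b hb => isSublattice_latticeClosure.infClosed ha hb)
    (fun i _ => subset_latticeClosure ⟨i, rfl⟩)

theorem aux_forward {k W ι : Type*} [Field k] [AddCommGroup W] [Module k W] [Fintype ι]
    [DecidableEq ι]
    (X : ι → Submodule k W) (h : IsDistributiveCollection (Set.range X)) :
    ∃ F : Finset ι → Submodule k W, iSupIndep F ∧ ∀ S, S.inf X = ⨆ T ∈ Set.Ici S, F T := by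
  classical
  have hex : ∀ S : Finset ι, ∃ a' : Submodule k W,
      Disjoint (S.inf X ⊓ Sᶜ.sup X) a' ∧ (S.inf X ⊓ Sᶜ.sup X) ⊔ a' = S.inf X :=
    fun S => IsModularLattice.exists_disjoint_and_sup_eq inf_le_left
  choose F hFd hFs using hex
  have hFle : ∀ S, F S ≤ S.inf X := fun S => le_sup_right.trans (hFs S).le
  have hFX : ∀ S, ∀ i ∈ S, F S ≤ X i := fun S i hi => (hFle S).trans (Finset.inf_le hi)
  have hdist : ∀ S : Finset ι, S.inf X ⊓ Sᶜ.sup X = Sᶜ.sup fun i => S.inf X ⊓ X i := by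
    intro S
    rcases S.eq_empty_or_nonempty with rfl | hS
    · simp
    · exact (aux_inf_sup X h _ (aux_inf_mem X S hS) _).1
  refine ⟨F, ?_, ?_⟩
  · rw [iSupIndep_iff_finsetSum_eq_zero_imp_eq_zero]
    intro s v hv hsum
    by_contra! hne
    obtain ⟨S, hS, hmin⟩ := Finset.exists_min_image (s.filter fun S => v S ≠ 0) Finset.card
      (by obtain ⟨S, hS, hS'⟩ := hne; exact ⟨S, by simp [hS, hS']⟩)
    rw [Finset.mem_filter] at hS
    apply hS.2
    refine Submodule.disjoint_def.1 (hFd S) _ ⟨hFle S (hv S hS.1), ?_⟩ (hv S hS.1)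
    rw [← Finset.add_sum_erase _ _ hS.1, add_eq_zero_iff_eq_neg] at hsum
    rw [hsum]
    refine neg_mem (sum_mem fun T hT => ?_)
    rw [Finset.mem_erase] at hT
    by_cases h0 : v T = 0
    · rw [h0]; exact zero_mem _
    have hc := hmin T (by simp [hT.2, h0])
    have : ¬ T ⊆ S := fun hTS => hT.1 (Finset.eq_of_subset_of_card_le hTS hc)
    obtain ⟨i, hiT, hiS⟩ := Finset.not_subset.1 this
    exact Finset.le_sup (f := X) (Finset.mem_compl.2 hiS) (hFX T i hiT (hv T hT.2))
  · intro S
    apply le_antisymm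
    · induction hn : Sᶜ.card using Nat.strong_induction_on generalizing S with
      | _ n ih =>
        rw [← hFs S, hdist]
        refine sup_le (Finset.sup_le fun i hi => ?_) (le_biSup F (Set.mem_Ici.2 le_rfl))
        have hi' := Finset.mem_compl.1 hi
        have h1 : S.inf X ⊓ X i = (insert i S).inf X := by rw [Finset.inf_insert, inf_comm]
        rw [h1]
        refine (ih _ ?_ (insert i S) rfl).trans
          (biSup_mono fun T hT => (Finset.subset_insert i S).trans hT)
        rw [← hn]
        apply Finset.card_lt_card
        rw [Finset.compl_ssubset_compl]
        exact Finset.ssubset_insert hi'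
    · exact iSup₂_le fun T hT => (hFle T).trans (Finset.inf_mono hT)

theorem aux_le_biSup {α H : Type*} [CompleteLattice α] (G : H → α) (A : Set H) (x : H)
    (hx : x ∈ A) : G x ≤ ⨆ η ∈ A, G η := le_biSup G hx

/-- Proposition (Polishchuk–Positselski): a finite collection `X 1, …, X N` of subspaces of a
vector space `W` is distributive if and only if there is an internal direct sum decomposition
`W = ⨁_{η ∈ H} W_η` such that each `X i` is the (direct) sum of a subfamily of the `W_η`. -/
theorem distributive_iff_exists_internal_directSum_decomposition
    {k W : Type*} [Field k] [AddCommGroup W] [Module k W]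
    (N : ℕ) (X : Fin N → Submodule k W) :
    IsDistributiveCollection (Set.range X) ↔
      ∃ (H : Type _) (Wfam : H → Submodule k W),
        iSupIndep Wfam ∧ (⨆ η, Wfam η) = ⊤ ∧
        ∀ i : Fin N, ∃ Hi : Set H, X i = ⨆ η ∈ Hi, Wfam η := by
  constructor
  · intro h
    obtain ⟨F, hF, hS⟩ := aux_forward X h
    refine ⟨ULift (Finset (Fin N)), fun x => F x.down, hF.comp ULift.down_injective, ?_, ?_⟩
    · have h0 := hS ∅
      rw [Finset.inf_empty] at h0
      rw [eq_top_iff, h0]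
      exact iSup₂_le fun T _ => le_iSup (fun x : ULift (Finset (Fin N)) => F x.down) ⟨T⟩
    · intro i
      refine ⟨{x | {i} ≤ x.down}, ?_⟩
      have h0 := hS {i}
      rw [Finset.inf_singleton] at h0
      rw [h0]
      apply le_antisymm
      · exact iSup₂_le fun T hT => by
          exact aux_le_biSup (fun x => F (ULift.down x)) {x | {i} ≤ ULift.down x} (ULift.up T) hT
      · exact iSup₂_le fun T hT => le_biSup F hT
  · rintro ⟨H, F, hF, -, hX⟩
    refine aux_backward F hF _ ?_
    rintro _ ⟨i, rfl⟩
    exact hX i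
end

section
/- Let k be a field and let Y and Z be vector spaces over k. Suppose W_1, W_2, …, W_M are subspaces of Y whose collection is distributive in Y, and X_1, X_2, …, X_N are subspaces of Z whose collection is distributive in Z. Then the collection of subspaces W_1 ⊗ Z, W_2 ⊗ Z, …, W_M ⊗ Z, Y ⊗ X_1, Y ⊗ X_2, …, Y ⊗ X_N is distributive in the tensor product Y ⊗ Z. -/
open TensorProduct

universe u

/-- Finite distributivity inside a distributive collection. -/
theorem IsDistributiveCollection.inf_finset_sup {k Y : Type*} [Field k] [AddCommGroup Y]
    [Module k Y] {n : ℕ} {W : Fin n → Submodule k Y}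
    (hW : IsDistributiveCollection (Set.range W)) (S T : Finset (Fin n)) :
    S.inf W ⊓ T.sup W = T.sup (fun i => S.inf W ⊓ W i) := by
  classical
  have hmem : ∀ i, W i ∈ latticeClosure (Set.range W) := fun i =>
    subset_latticeClosure ⟨i, rfl⟩
  have hinf : S = ∅ ∨ S.inf W ∈ latticeClosure (Set.range W) := by
    induction S using Finset.induction_on with
    | empty => exact Or.inl rfl
    | insert a S ha ih =>
      right
      rw [Finset.inf_insert]
      rcases ih with rfl | ih
      · simpa using hmem a
      · exact isSublattice_latticeClosure.infClosed (hmem a) ih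
  rcases hinf with rfl | hinf
  · simp
  suffices H : S.inf W ⊓ T.sup W = T.sup (fun i => S.inf W ⊓ W i) ∧
      (T = ∅ ∨ T.sup W ∈ latticeClosure (Set.range W)) from H.1
  induction T using Finset.induction_on with
  | empty => simp
  | insert a T ha ih =>
    obtain ⟨h1, h2⟩ := ih
    rw [Finset.sup_insert, Finset.sup_insert]
    rcases h2 with rfl | h2
    · simpa using hmem a
    · exact ⟨by rw [hW _ hinf _ (hmem a) _ h2, h1],
        Or.inr (isSublattice_latticeClosure.supClosed (hmem a) h2)⟩

/-- A finite distributive collection admits an adapted basis. -/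
theorem IsDistributiveCollection.exists_basis {k : Type*} {Y : Type u} [Field k] [AddCommGroup Y]
    [Module k Y] {n : ℕ} {W : Fin n → Submodule k Y}
    (hW : IsDistributiveCollection (Set.range W)) :
    ∃ (ι : Type u) (b : Module.Basis ι k Y) (A : Fin n → Set ι),
      ∀ i, W i = Submodule.span k (b '' A i) := by
  classical
  have hC : ∀ S : Finset (Fin n), ∃ C : Submodule k Y, C ≤ S.inf W ∧
      Disjoint C (S.inf W ⊓ Sᶜ.sup W) ∧ S.inf W ≤ C ⊔ (S.inf W ⊓ Sᶜ.sup W) := by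
    intro S
    obtain ⟨D, hD⟩ := Submodule.exists_isCompl (S.inf W ⊓ Sᶜ.sup W)
    refine ⟨D ⊓ S.inf W, inf_le_right, hD.disjoint.symm.mono_left inf_le_left, ?_⟩
    rw [sup_comm, ← sup_inf_assoc_of_le _ (inf_le_left), hD.sup_eq_top, top_inf_eq]
  choose C hC1 hC2 hC3 using hC
  have hspan : ∀ S : Finset (Fin n), S.inf W = ⨆ T : {T : Finset (Fin n) // S ⊆ T}, C T := by
    intro S
    apply le_antisymm
    · induction S using WellFoundedGT.induction with
      | ind S ih =>
        refine (hC3 S).trans (sup_le ?_ ?_)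
        · exact le_iSup (fun T : {T : Finset (Fin n) // S ⊆ T} => C T) ⟨S, subset_rfl⟩
        · rw [hW.inf_finset_sup]
          refine Finset.sup_le fun i hi => ?_
          have hi' : i ∉ S := by simpa using hi
          have h := ih (insert i S) (Finset.ssubset_insert hi')
          rw [Finset.inf_insert, inf_comm] at h
          refine h.trans (iSup_le fun T => ?_)
          exact le_iSup (fun T : {T : Finset (Fin n) // S ⊆ T} => C T)
            ⟨T.1, (Finset.subset_insert i S).trans T.2⟩
    · exact iSup_le fun T => (hC1 T).trans (Finset.inf_mono T.2)
  have htop : ⨆ T, C T = ⊤ := by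
    rw [eq_top_iff]
    have h := hspan ∅
    rw [Finset.inf_empty] at h
    rw [h]
    exact iSup_le fun T => le_iSup C T
  have hind : iSupIndep C := by
    rw [iSupIndep_iff_finsetSum_eq_zero_imp_eq_zero]
    intro s v hv h0
    by_contra! hne
    obtain ⟨S, ⟨hSs, hS0⟩, hmin⟩ :=
      exists_minimal_of_wellFoundedLT (fun S => S ∈ s ∧ v S ≠ 0) hne
    apply hS0
    refine Submodule.disjoint_def.1 (hC2 S) _ (hv S hSs) ⟨hC1 S (hv S hSs), ?_⟩
    rw [← s.add_sum_erase _ hSs, add_eq_zero_iff_eq_neg] at h0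
    rw [h0]
    refine Submodule.neg_mem _ (Submodule.sum_mem _ fun T hT => ?_)
    rw [Finset.mem_erase] at hT
    by_cases hT0 : v T = 0
    · rw [hT0]; exact Submodule.zero_mem _
    have hTS : ¬ T ⊆ S := fun h => hT.1 (h.antisymm (hmin ⟨hT.2, hT0⟩ h))
    obtain ⟨i, hiT, hiS⟩ := Finset.not_subset.1 hTS
    have h1 : C T ≤ W i := (hC1 T).trans (Finset.inf_le hiT)
    have h2 : W i ≤ Sᶜ.sup W := Finset.le_sup (f := W) (by simpa using hiS)
    exact h2 (h1 (hv T hT.2))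
  have hint := DirectSum.isInternal_submodule_of_iSupIndep_of_iSup_eq_top hind htop
  let v := fun S => Module.Basis.ofVectorSpace k (C S)
  have hv : ∀ S, C S = Submodule.span k (Set.range fun a => (v S a : Y)) := by
    intro S
    have h := congrArg (Submodule.map (C S).subtype) (v S).span_eq
    rw [Submodule.map_span, Submodule.map_top, Submodule.range_subtype, ← Set.range_comp] at h
    exact h.symm
  refine ⟨_, hint.collectedBasis v, fun i => {a | i ∈ a.1}, fun i => ?_⟩
  apply le_antisymm
  · have h := hspan {i}
    rw [Finset.inf_singleton] at h
    rw [h]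
    refine iSup_le fun T => ?_
    rw [hv T.1, Submodule.span_le]
    rintro _ ⟨a, rfl⟩
    refine Submodule.subset_span ⟨⟨T.1, a⟩, ?_, ?_⟩
    · exact T.2 (Finset.mem_singleton_self i)
    · simp
  · rw [Submodule.span_le]
    rintro _ ⟨a, ha, rfl⟩
    exact ((hC1 a.1).trans (Finset.inf_le ha)) (hint.collectedBasis_mem v a)

/-- A collection of subspaces spanned by parts of a fixed basis is distributive. -/
theorem isDistributiveCollection_of_basis {k Y ι : Type*} [Field k] [AddCommGroup Y]
    [Module k Y] (b : Module.Basis ι k Y) (𝒮 : Set (Submodule k Y))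
    (h : ∀ P ∈ 𝒮, ∃ A : Set ι, P = Submodule.span k (b '' A)) :
    IsDistributiveCollection 𝒮 := by
  have hsup : ∀ A B : Set ι, Submodule.span k (b '' A) ⊔ Submodule.span k (b '' B) =
      Submodule.span k (b '' (A ∪ B)) := by
    intro A B
    rw [Set.image_union, Submodule.span_union]
  have hinf : ∀ A B : Set ι, Submodule.span k (b '' A) ⊓ Submodule.span k (b '' B) =
      Submodule.span k (b '' (A ∩ B)) := by
    intro A B
    ext x
    simp only [Submodule.mem_inf, Module.Basis.mem_span_image, Set.subset_inter_iff]
  have hcl : latticeClosure 𝒮 ⊆ Set.range (fun A : Set ι => Submodule.span k (b '' A)) := by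
    apply latticeClosure_min
    · intro P hP
      obtain ⟨A, rfl⟩ := h P hP
      exact ⟨A, rfl⟩
    · constructor
      · rintro _ ⟨A, rfl⟩ _ ⟨B, rfl⟩
        exact ⟨A ∪ B, (hsup A B).symm⟩
      · rintro _ ⟨A, rfl⟩ _ ⟨B, rfl⟩
        exact ⟨A ∩ B, (hinf A B).symm⟩
  intro p hp q hq r hr
  obtain ⟨A, rfl⟩ := hcl hp
  obtain ⟨B, rfl⟩ := hcl hq
  obtain ⟨D, rfl⟩ := hcl hr
  simp only [hsup, hinf, Set.inter_union_distrib_left]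

theorem map₂_mk_span_basis {k Y Z ι κ : Type*} [Field k] [AddCommGroup Y] [Module k Y]
    [AddCommGroup Z] [Module k Z] (b : Module.Basis ι k Y) (c : Module.Basis κ k Z)
    (A : Set ι) (B : Set κ) :
    Submodule.map₂ (TensorProduct.mk k Y Z) (Submodule.span k (b '' A))
      (Submodule.span k (c '' B)) = Submodule.span k (b.tensorProduct c '' (A ×ˢ B)) := by
  rw [Submodule.map₂_span_span]
  congr 1
  ext x
  constructor
  · rintro ⟨_, ⟨i, hi, rfl⟩, _, ⟨j, hj, rfl⟩, rfl⟩
    exact ⟨(i, j), ⟨hi, hj⟩, by simp [Module.Basis.tensorProduct_apply]⟩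
  · rintro ⟨⟨i, j⟩, ⟨hi, hj⟩, rfl⟩
    exact ⟨_, ⟨i, hi, rfl⟩, _, ⟨j, hj, rfl⟩, by simp [Module.Basis.tensorProduct_apply]⟩

/-- If the subspaces `W 1, …, W M` generate a distributive lattice in `Y` and the subspaces
`X 1, …, X N` generate a distributive lattice in `Z`, then the subspaces
`W 1 ⊗ Z, …, W M ⊗ Z, Y ⊗ X 1, …, Y ⊗ X N` generate a distributive lattice in `Y ⊗ Z`.
Here `P ⊗ Z` denotes the range of `(inclusion of P) ⊗ id_Z` and `Y ⊗ Q` the range of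
`id_Y ⊗ (inclusion of Q)`. -/
theorem distributive_tensor_distributive
    {k Y Z : Type*} [Field k] [AddCommGroup Y] [Module k Y] [AddCommGroup Z] [Module k Z]
    (M N : ℕ) (W : Fin M → Submodule k Y) (X : Fin N → Submodule k Z)
    (hW : IsDistributiveCollection (Set.range W))
    (hX : IsDistributiveCollection (Set.range X)) :
    IsDistributiveCollection
      ((Set.range fun i : Fin M =>
          LinearMap.range (TensorProduct.map (W i).subtype (LinearMap.id : Z →ₗ[k] Z))) ∪
       (Set.range fun j : Fin N =>
          LinearMap.range (TensorProduct.map (LinearMap.id : Y →ₗ[k] Y) (X j).subtype))) := by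
  obtain ⟨ι, b, A, hA⟩ := hW.exists_basis
  obtain ⟨κ, c, B, hB⟩ := hX.exists_basis
  refine isDistributiveCollection_of_basis (b.tensorProduct c) _ ?_
  rintro P (⟨i, rfl⟩ | ⟨j, rfl⟩)
  · refine ⟨A i ×ˢ Set.univ, ?_⟩
    beta_reduce
    rw [← map₂_mk_span_basis, ← hA, Set.image_univ, c.span_eq, TensorProduct.range_map,
      Submodule.range_subtype, LinearMap.range_id]
  · refine ⟨Set.univ ×ˢ B j, ?_⟩
    beta_reduce
    rw [← map₂_mk_span_basis, ← hB, Set.image_univ, b.span_eq, TensorProduct.range_map,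
      Submodule.range_subtype, LinearMap.range_id]
end

section
/- Let k be a field and let V = ⨁_{i ∈ I} V_[i] be an internal direct sum decomposition of a vector space V over k into subspaces V_[i]. Let {X_j | j ∈ J} be a collection of subspaces of V, and assume each X_j is graded with respect to this decomposition, i.e., X_j = ⨁_{i ∈ I} (X_j ∩ V_[i]). Then the collection {X_j | j ∈ J} is distributive in V if and only if, for every i ∈ I, the collection {X_j ∩ V_[i] | j ∈ J} is distributive in V_[i]. -/
/-- Homogeneous subspaces: stable under all the component projections. -/
def HomogSub {k V I : Type*} [Field k] [AddCommGroup V] [Module k V]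
    (p : I → V →ₗ[k] V) (Y : Submodule k V) : Prop :=
  ∀ i, ∀ x ∈ Y, p i x ∈ Y

theorem HomogSub.inf {k V I : Type*} [Field k] [AddCommGroup V] [Module k V]
    {p : I → V →ₗ[k] V} {A B : Submodule k V} (hA : HomogSub p A) (hB : HomogSub p B) :
    HomogSub p (A ⊓ B) :=
  fun i x hx => ⟨hA i x hx.1, hB i x hx.2⟩

theorem HomogSub.sup {k V I : Type*} [Field k] [AddCommGroup V] [Module k V]
    {p : I → V →ₗ[k] V} {A B : Submodule k V} (hA : HomogSub p A) (hB : HomogSub p B) :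
    HomogSub p (A ⊔ B) := by
  intro i x hx
  obtain ⟨a, ha, b, hb, rfl⟩ := Submodule.mem_sup.1 hx
  rw [map_add]
  exact Submodule.add_mem_sup (hA i a ha) (hB i b hb)

theorem HomogSub.comap_sup {k V I : Type*} [Field k] [AddCommGroup V] [Module k V]
    {p : I → V →ₗ[k] V} {A B : Submodule k V} (hA : HomogSub p A) (hB : HomogSub p B)
    (W : Submodule k V) (i : I) (hmem : ∀ x, p i x ∈ W) (hid : ∀ x ∈ W, p i x = x) :
    Submodule.comap W.subtype (A ⊔ B) =
      Submodule.comap W.subtype A ⊔ Submodule.comap W.subtype B := by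
  apply le_antisymm
  · rintro ⟨v, hv⟩ hx
    obtain ⟨a, ha, b, hb, hab⟩ := Submodule.mem_sup.1 (Submodule.mem_comap.1 hx)
    refine Submodule.mem_sup.2 ⟨⟨p i a, hmem a⟩, hA i a ha, ⟨p i b, hmem b⟩, hB i b hb, ?_⟩
    apply Subtype.ext
    change p i a + p i b = v
    rw [← map_add, hab]
    exact hid v hv
  · exact sup_le (Submodule.comap_mono le_sup_left) (Submodule.comap_mono le_sup_right)

/-- Existence of the component projections. -/
theorem exists_component_projections {k V I : Type*} [Field k] [AddCommGroup V] [Module k V]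
    (Vfam : I → Submodule k V) (hIndep : iSupIndep Vfam) (hTop : (⨆ i, Vfam i) = ⊤) :
    ∃ p : I → V →ₗ[k] V, (∀ i x, p i x ∈ Vfam i) ∧ (∀ i, ∀ x ∈ Vfam i, p i x = x) ∧
      (∀ i j, i ≠ j → ∀ x ∈ Vfam i, p j x = 0) ∧
      (∀ x, ∃ s : Finset I, x = ∑ i ∈ s, p i x) := by
  classical
  have hint := DirectSum.isInternal_submodule_of_iSupIndep_of_iSup_eq_top hIndep hTop
  letI := hint.chooseDecomposition
  refine ⟨fun i => (Vfam i).subtype ∘ₗ DirectSum.component k I (fun i => Vfam i) i ∘ₗ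
    (DirectSum.decomposeLinearEquiv Vfam).toLinearMap, ?_, ?_, ?_, ?_⟩
  · intro i x
    exact Subtype.mem _
  · intro i x hx
    exact DirectSum.decompose_of_mem_same Vfam hx
  · intro i j hij x hx
    exact DirectSum.decompose_of_mem_ne Vfam hx hij
  · intro x
    exact ⟨_, (DirectSum.sum_support_decompose Vfam x).symm⟩

/-- Let `V = ⨁_{i ∈ I} V_[i]` be an internal direct sum decomposition of a vector space `V`
(the subspaces `V i` are independent and their sum is all of `V`), and let `{X j | j ∈ J}` be a
collection of subspaces of `V`, each graded with respect to the decomposition: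
`X j = ⨁_{i ∈ I} (X j ∩ V i)`.  Then `{X j | j ∈ J}` is distributive in `V` if and only if for
every `i ∈ I` the collection `{X j ∩ V i | j ∈ J}` is distributive in `V_[i]` (formalized via
the pullback `comap (V i).subtype (X j)`, a subspace of `↥(V i)`). -/
theorem distributive_iff_forall_graded_component_distributive
    {k V : Type*} [Field k] [AddCommGroup V] [Module k V]
    {I J : Type*} (Vfam : I → Submodule k V)
    (hIndep : iSupIndep Vfam) (hTop : (⨆ i, Vfam i) = ⊤)
    (X : J → Submodule k V)
    (hGraded : ∀ j, X j = ⨆ i, X j ⊓ Vfam i) :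
    IsDistributiveCollection (Set.range X) ↔
      ∀ i : I, IsDistributiveCollection
        (Set.range fun j : J => Submodule.comap (Vfam i).subtype (X j)) := by
  obtain ⟨p, hmem, hid, hne, hsum⟩ := exists_component_projections Vfam hIndep hTop
  have hX : ∀ j, HomogSub p (X j) := by
    intro j i x hx
    have hle : (⨆ i', X j ⊓ Vfam i') ≤ Submodule.comap (p i) (X j) := by
      refine iSup_le fun i' y hy => ?_
      rw [Submodule.mem_comap]
      by_cases h : i' = i
      · subst h
        rw [hid _ y hy.2]
        exact hy.1
      · rw [hne i' i h y hy.2]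
        exact zero_mem _
    rw [hGraded j] at hx
    exact hle hx
  have hle : ∀ A B : Submodule k V, HomogSub p A →
      (∀ i, Submodule.comap (Vfam i).subtype A ≤ Submodule.comap (Vfam i).subtype B) →
      A ≤ B := by
    intro A B hA h x hx
    obtain ⟨s, hs⟩ := hsum x
    rw [hs]
    refine Submodule.sum_mem _ fun i _ => ?_
    have h1 : (⟨p i x, hmem i x⟩ : Vfam i) ∈ Submodule.comap (Vfam i).subtype A := hA i x hx
    exact h i h1
  have hcs : ∀ (i : I) (A B : Submodule k V), HomogSub p A → HomogSub p B →
      Submodule.comap (Vfam i).subtype (A ⊔ B) =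
      Submodule.comap (Vfam i).subtype A ⊔ Submodule.comap (Vfam i).subtype B :=
    fun i A B hA hB => hA.comap_sup hB (Vfam i) i (hmem i) (hid i)
  have hfwd : latticeClosure (Set.range X) ⊆ {A | HomogSub p A ∧ ∀ i,
      Submodule.comap (Vfam i).subtype A ∈ latticeClosure
        (Set.range fun j : J => Submodule.comap (Vfam i).subtype (X j))} := by
    refine latticeClosure_min ?_ ⟨?_, ?_⟩
    · rintro _ ⟨j, rfl⟩
      exact ⟨hX j, fun i => subset_latticeClosure ⟨j, rfl⟩⟩
    · rintro A ⟨hA, hA'⟩ B ⟨hB, hB'⟩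
      refine ⟨hA.sup hB, fun i => ?_⟩
      rw [hcs i A B hA hB]
      exact isSublattice_latticeClosure.supClosed (hA' i) (hB' i)
    · rintro A ⟨hA, hA'⟩ B ⟨hB, hB'⟩
      refine ⟨hA.inf hB, fun i => ?_⟩
      rw [Submodule.comap_inf]
      exact isSublattice_latticeClosure.infClosed (hA' i) (hB' i)
  have hbwd : ∀ i, latticeClosure
      (Set.range fun j : J => Submodule.comap (Vfam i).subtype (X j)) ⊆
      {a | ∃ A ∈ latticeClosure (Set.range X), Submodule.comap (Vfam i).subtype A = a} := by
    intro i
    refine latticeClosure_min ?_ ⟨?_, ?_⟩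
    · rintro _ ⟨j, rfl⟩
      exact ⟨X j, subset_latticeClosure ⟨j, rfl⟩, rfl⟩
    · rintro _ ⟨A, hA, rfl⟩ _ ⟨B, hB, rfl⟩
      exact ⟨A ⊔ B, isSublattice_latticeClosure.supClosed hA hB,
        hcs i A B (hfwd hA).1 (hfwd hB).1⟩
    · rintro _ ⟨A, hA, rfl⟩ _ ⟨B, hB, rfl⟩
      exact ⟨A ⊓ B, isSublattice_latticeClosure.infClosed hA hB, Submodule.comap_inf _ _ _⟩
  constructor
  · intro h i a ha b hb c hc
    obtain ⟨A, hA, rfl⟩ := hbwd i ha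
    obtain ⟨B, hB, rfl⟩ := hbwd i hb
    obtain ⟨C, hC, rfl⟩ := hbwd i hc
    have hA' := (hfwd hA).1
    have hB' := (hfwd hB).1
    have hC' := (hfwd hC).1
    rw [← hcs i B C hB' hC', ← Submodule.comap_inf, ← Submodule.comap_inf,
      ← Submodule.comap_inf, ← hcs i _ _ (hA'.inf hB') (hA'.inf hC'), h A hA B hB C hC]
  · intro h A hA B hB C hC
    obtain ⟨hA', hA2⟩ := hfwd hA
    obtain ⟨hB', hB2⟩ := hfwd hB
    obtain ⟨hC', hC2⟩ := hfwd hC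
    refine le_antisymm (hle _ _ (hA'.inf (hB'.sup hC')) fun i => ?_) le_inf_sup
    rw [hcs i _ _ (hA'.inf hB') (hA'.inf hC'), Submodule.comap_inf, Submodule.comap_inf,
      Submodule.comap_inf, hcs i B C hB' hC']
    exact (h i _ (hA2 i) _ (hB2 i) _ (hC2 i)).le
end

section
/- Let k be a field, let Y, W, Z be vector spaces over k, and let X_1, …, X_N be subspaces of W. If the collection X_1, …, X_N is distributive in W, then the collection of subspaces Y ⊗ X_1 ⊗ Z, Y ⊗ X_2 ⊗ Z, …, Y ⊗ X_N ⊗ Z is distributive in Y ⊗ W ⊗ Z. -/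
open TensorProduct

section Aux
variable {k Y W Z : Type*} [Field k] [AddCommGroup Y] [Module k Y]
    [AddCommGroup W] [Module k W] [AddCommGroup Z] [Module k Z]

/-- The subspace `Y ⊗ P ⊗ Z` of `Y ⊗ W ⊗ Z`. -/
def midTensor (Y Z : Type*) [AddCommGroup Y] [Module k Y] [AddCommGroup Z] [Module k Z]
    (P : Submodule k W) : Submodule k (Y ⊗[k] (W ⊗[k] Z)) :=
  LinearMap.range (TensorProduct.map (LinearMap.id : Y →ₗ[k] Y)
    (TensorProduct.map P.subtype (LinearMap.id : Z →ₗ[k] Z)))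

lemma midTensor_tmul_mem {P : Submodule k W} (y : Y) {w : W} (hw : w ∈ P) (z : Z) :
    y ⊗ₜ[k] (w ⊗ₜ[k] z) ∈ midTensor Y Z P :=
  ⟨y ⊗ₜ[k] ((⟨w, hw⟩ : P) ⊗ₜ[k] z), by simp⟩

lemma midTensor_le {P : Submodule k W} {S : Submodule k (Y ⊗[k] (W ⊗[k] Z))}
    (h : ∀ (y : Y) (w : W) (z : Z), w ∈ P → y ⊗ₜ[k] (w ⊗ₜ[k] z) ∈ S) :
    midTensor Y Z P ≤ S := by
  rintro _ ⟨u, rfl⟩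
  induction u with
  | zero => simp
  | add a b ha hb => rw [map_add]; exact S.add_mem ha hb
  | tmul y t =>
    induction t with
    | zero => simp
    | add a b ha hb => rw [TensorProduct.tmul_add, map_add]; exact S.add_mem ha hb
    | tmul p z => simpa using h y p z p.2

lemma midTensor_mono {P Q : Submodule k W} (h : P ≤ Q) :
    midTensor Y Z P ≤ midTensor Y Z Q :=
  midTensor_le fun y _ z hw => midTensor_tmul_mem y (h hw) z

lemma midTensor_sup (P Q : Submodule k W) :
    midTensor Y Z (P ⊔ Q) = midTensor Y Z P ⊔ midTensor Y Z Q := by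
  apply le_antisymm
  · refine midTensor_le fun y w z hw => ?_
    obtain ⟨p, hp, q, hq, rfl⟩ := Submodule.mem_sup.1 hw
    rw [TensorProduct.add_tmul, TensorProduct.tmul_add]
    exact Submodule.add_mem_sup (midTensor_tmul_mem y hp z) (midTensor_tmul_mem y hq z)
  · exact sup_le (midTensor_mono le_sup_left) (midTensor_mono le_sup_right)

lemma midTensor_inf (P Q : Submodule k W) :
    midTensor Y Z (P ⊓ Q) = midTensor Y Z P ⊓ midTensor Y Z Q := by
  apply le_antisymm
  · exact le_inf (midTensor_mono inf_le_left) (midTensor_mono inf_le_right)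
  · rintro _ ⟨⟨u, rfl⟩, ⟨v, hv⟩⟩
    let g : P →ₗ[k] W ⧸ Q := Q.mkQ ∘ₗ P.subtype
    have hex : Function.Exact (LinearMap.ker g).subtype g := LinearMap.exact_subtype_ker_map g
    have hex2 := Module.Flat.lTensor_exact Y (Module.Flat.rTensor_exact Z hex)
    have hz : (LinearMap.lTensor Y (LinearMap.rTensor Z g)) u = 0 := by
      have h1 : LinearMap.lTensor Y (LinearMap.rTensor Z g) u =
          LinearMap.lTensor Y (LinearMap.rTensor Z Q.mkQ)
            (LinearMap.lTensor Y (LinearMap.rTensor Z P.subtype) u) := by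
        simp only [g, LinearMap.rTensor_comp, LinearMap.lTensor_comp, LinearMap.comp_apply]
      have h2 : LinearMap.lTensor Y (LinearMap.rTensor Z P.subtype) u =
          LinearMap.lTensor Y (LinearMap.rTensor Z Q.subtype) v := hv.symm
      have h3 : Q.mkQ ∘ₗ Q.subtype = 0 := by ext; simp
      rw [h1, h2, ← LinearMap.comp_apply, ← LinearMap.lTensor_comp, ← LinearMap.rTensor_comp, h3]
      simp
    obtain ⟨t, rfl⟩ := (hex2 u).1 hz
    clear hv hz
    induction t with
    | zero => simp
    | add a b ha hb => rw [map_add, map_add]; exact Submodule.add_mem _ ha hb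
    | tmul y t =>
      induction t with
      | zero => simp
      | add a b ha hb =>
        rw [TensorProduct.tmul_add, map_add, map_add]; exact Submodule.add_mem _ ha hb
      | tmul p z =>
        have hp : g p = 0 := p.2
        have hq : ((p : P) : W) ∈ Q := (Submodule.Quotient.mk_eq_zero Q).1 hp
        simpa using midTensor_tmul_mem (P := P ⊓ Q) y ⟨(p : P).2, hq⟩ z

end Aux

/-- If `X 1, …, X N` is a distributive collection of subspaces of `W`, then
`Y ⊗ X 1 ⊗ Z, …, Y ⊗ X N ⊗ Z` is a distributive collection of subspaces of `Y ⊗ W ⊗ Z`.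
Here `Y ⊗ P ⊗ Z` denotes the range of `id_Y ⊗ (inclusion of P) ⊗ id_Z`. -/
theorem distributive_of_middle_distributive
    {k Y W Z : Type*} [Field k] [AddCommGroup Y] [Module k Y]
    [AddCommGroup W] [Module k W] [AddCommGroup Z] [Module k Z]
    (N : ℕ) (X : Fin N → Submodule k W)
    (hX : IsDistributiveCollection (Set.range X)) :
    IsDistributiveCollection
      (Set.range fun i : Fin N =>
        LinearMap.range (TensorProduct.map (LinearMap.id : Y →ₗ[k] Y)
          (TensorProduct.map (X i).subtype (LinearMap.id : Z →ₗ[k] Z)))) := by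
  change IsDistributiveCollection (Set.range fun i => midTensor Y Z (X i))
  have key : latticeClosure (Set.range fun i => midTensor Y Z (X i)) =
      midTensor Y Z '' latticeClosure (Set.range X) := by
    rw [image_latticeClosure _ _ (fun a b => midTensor_sup a b)
      (fun a b => midTensor_inf a b), ← Set.range_comp]
    rfl
  unfold IsDistributiveCollection
  rw [key]
  rintro _ ⟨a, ha, rfl⟩ _ ⟨b, hb, rfl⟩ _ ⟨c, hc, rfl⟩
  rw [← midTensor_sup, ← midTensor_inf, hX a ha b hb c hc, midTensor_sup, midTensor_inf,
    midTensor_inf]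
end

section
/- Let k be a field, let Y, W, Z be nonzero vector spaces over k, and let X_1, …, X_N be subspaces of W. If the collection of subspaces Y ⊗ X_1 ⊗ Z, Y ⊗ X_2 ⊗ Z, …, Y ⊗ X_N ⊗ Z is distributive in Y ⊗ W ⊗ Z, then the collection X_1, …, X_N is distributive in W. -/
open TensorProduct

section Helpers

variable {k Y W Z : Type*} [Field k] [AddCommGroup Y] [Module k Y]
    [AddCommGroup W] [Module k W] [AddCommGroup Z] [Module k Z]

/-- The subspace `Y ⊗ P ⊗ Z`. -/
def midF (Y Z : Type*) [AddCommGroup Y] [Module k Y] [AddCommGroup Z] [Module k Z]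
    (P : Submodule k W) : Submodule k (Y ⊗[k] (W ⊗[k] Z)) :=
  LinearMap.range (TensorProduct.map (LinearMap.id : Y →ₗ[k] Y)
          (TensorProduct.map P.subtype (LinearMap.id : Z →ₗ[k] Z)))

/-- The map `id ⊗ f ⊗ id`. -/
def midT (Y Z : Type*) [AddCommGroup Y] [Module k Y] [AddCommGroup Z] [Module k Z]
    {V U : Type*} [AddCommGroup V] [Module k V] [AddCommGroup U] [Module k U]
    (f : V →ₗ[k] U) : Y ⊗[k] (V ⊗[k] Z) →ₗ[k] Y ⊗[k] (U ⊗[k] Z) :=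
  TensorProduct.map LinearMap.id (TensorProduct.map f LinearMap.id)

lemma midT_comp {V U S : Type*} [AddCommGroup V] [Module k V] [AddCommGroup U] [Module k U]
    [AddCommGroup S] [Module k S] (g : U →ₗ[k] S) (f : V →ₗ[k] U) (t) :
    midT Y Z (g ∘ₗ f) t = midT Y Z g (midT Y Z f t) := by
  have h : midT Y Z (g ∘ₗ f) = midT Y Z g ∘ₗ midT Y Z f := by
    simp only [midT, ← TensorProduct.map_comp, LinearMap.id_comp]
  rw [h]; rfl

lemma midT_add {V U : Type*} [AddCommGroup V] [Module k V] [AddCommGroup U] [Module k U]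
    (g f : V →ₗ[k] U) : midT Y Z (g + f) = midT Y Z g + midT Y Z f := by
  simp only [midT, TensorProduct.map_add_left, TensorProduct.map_add_right]

lemma midT_mem {V : Type*} [AddCommGroup V] [Module k V] (P : Submodule k W)
    (f : V →ₗ[k] W) (hf : ∀ x, f x ∈ P) (t) : midT Y Z f t ∈ midF Y Z P := by
  have : f = P.subtype ∘ₗ f.codRestrict P hf := by ext; rfl
  rw [this, midT_comp]
  exact ⟨_, rfl⟩

lemma midT_kill (P : Submodule k W) (t) (ht : t ∈ midF Y Z P) : midT Y Z P.mkQ t = 0 := by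
  obtain ⟨s, rfl⟩ := ht
  change midT Y Z P.mkQ (midT Y Z P.subtype s) = 0
  rw [← midT_comp]
  have : P.mkQ ∘ₗ P.subtype = 0 := by ext; simp
  rw [this]
  simp [midT]

lemma midF_mono {P Q : Submodule k W} (h : P ≤ Q) : midF Y Z P ≤ midF Y Z Q := by
  rintro _ ⟨s, rfl⟩
  exact midT_mem Q P.subtype (fun x => h x.2) s

lemma tmul_mem_midF {P : Submodule k W} (y : Y) {w : W} (hw : w ∈ P) (z : Z) :
    y ⊗ₜ[k] (w ⊗ₜ[k] z) ∈ midF Y Z P :=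
  ⟨y ⊗ₜ (⟨w, hw⟩ ⊗ₜ z), by simp⟩

lemma midF_sup (P Q : Submodule k W) : midF Y Z (P ⊔ Q) = midF Y Z P ⊔ midF Y Z Q := by
  apply le_antisymm
  · rintro _ ⟨s, rfl⟩
    induction s using TensorProduct.induction_on with
    | zero => simp
    | add a b ha hb => rw [map_add]; exact add_mem ha hb
    | tmul y s =>
      induction s using TensorProduct.induction_on with
      | zero => simp
      | add a b ha hb => rw [TensorProduct.tmul_add, map_add]; exact add_mem ha hb
      | tmul w z =>
        obtain ⟨w, hw⟩ := w
        obtain ⟨p, hp, q, hq, rfl⟩ := Submodule.mem_sup.1 hw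
        simp only [TensorProduct.map_tmul, LinearMap.id_apply, Submodule.subtype_apply,
          TensorProduct.add_tmul, TensorProduct.tmul_add]
        exact Submodule.add_mem_sup (tmul_mem_midF y hp z) (tmul_mem_midF y hq z)
  · exact sup_le (midF_mono le_sup_left) (midF_mono le_sup_right)

lemma midF_inf (P Q : Submodule k W) : midF Y Z (P ⊓ Q) = midF Y Z P ⊓ midF Y Z Q := by
  apply le_antisymm
  · exact le_inf (midF_mono inf_le_left) (midF_mono inf_le_right)
  · rintro t ⟨hP, hQ⟩
    let f : W →ₗ[k] (W ⧸ P) × (W ⧸ Q) := P.mkQ.prod Q.mkQ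
    obtain ⟨s, hs⟩ := f.rangeRestrict.exists_rightInverse_of_surjective f.range_rangeRestrict
    obtain ⟨g, hg⟩ := LinearMap.exists_extend s
    have hfg : ∀ x, f (g (f x)) = f x := by
      intro x
      have h1 : g (f x) = s (f.rangeRestrict x) := by rw [← hg]; rfl
      have h2 := congrArg Subtype.val (LinearMap.congr_fun hs (f.rangeRestrict x))
      rw [h1]
      exact h2
    let g1 := g ∘ₗ LinearMap.inl k _ _
    let g2 := g ∘ₗ LinearMap.inr k _ _
    let e : W →ₗ[k] W := LinearMap.id - g ∘ₗ f
    have he : ∀ x, e x ∈ P ⊓ Q := by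
      intro x
      have h : f (e x) = 0 := by simp [e, hfg]
      have h1 := congrArg Prod.fst h
      have h2 := congrArg Prod.snd h
      exact ⟨(Submodule.Quotient.mk_eq_zero P).1 h1, (Submodule.Quotient.mk_eq_zero Q).1 h2⟩
    have hid : (LinearMap.id : W →ₗ[k] W) = e + (g1 ∘ₗ P.mkQ + g2 ∘ₗ Q.mkQ) := by
      ext x
      have : g (f x) = g (P.mkQ x, 0) + g (0, Q.mkQ x) := by
        rw [← map_add]; simp [f]
      simp only [e, g1, g2, LinearMap.add_apply, LinearMap.sub_apply, LinearMap.comp_apply,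
        LinearMap.inl_apply, LinearMap.inr_apply, LinearMap.id_apply, this]
      abel
    have ht : midT Y Z (LinearMap.id : W →ₗ[k] W) t = t := by
      simp [midT, TensorProduct.map_id]
    rw [hid, midT_add, midT_add, LinearMap.add_apply, LinearMap.add_apply, midT_comp g1, midT_comp g2,
      midT_kill P t hP, midT_kill Q t hQ, map_zero, map_zero, add_zero, add_zero] at ht
    rw [← ht]
    exact midT_mem _ e he t

lemma midF_le [Nontrivial Y] [Nontrivial Z] {P Q : Submodule k W}
    (h : midF Y Z P ≤ midF Y Z Q) : P ≤ Q := by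
  intro w hw
  obtain ⟨y, hy⟩ := exists_ne (0 : Y)
  obtain ⟨z, hz⟩ := exists_ne (0 : Z)
  have h1 := midT_kill Q _ (h (tmul_mem_midF y hw z))
  simp only [midT, TensorProduct.map_tmul, LinearMap.id_apply] at h1
  obtain ⟨φ, hφ⟩ : ∃ φ : Module.Dual k Y, φ y ≠ 0 := by
    by_contra! hc
    exact hy ((Module.forall_dual_apply_eq_zero_iff k y).1 hc)
  obtain ⟨ψ, hψ⟩ : ∃ ψ : Module.Dual k Z, ψ z ≠ 0 := by
    by_contra! hc
    exact hz ((Module.forall_dual_apply_eq_zero_iff k z).1 hc)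
  have h2 := congrArg ((TensorProduct.rid k _).toLinearMap ∘ₗ TensorProduct.map LinearMap.id ψ ∘ₗ
    (TensorProduct.lid k _).toLinearMap ∘ₗ TensorProduct.map φ LinearMap.id) h1
  simpa [hφ, hψ] using h2

lemma midF_inj [Nontrivial Y] [Nontrivial Z] {P Q : Submodule k W}
    (h : midF Y Z P = midF Y Z Q) : P = Q :=
  le_antisymm (midF_le h.le) (midF_le h.ge)

end Helpers

/-- Let `Y`, `W`, `Z` be nonzero vector spaces.  If the collection
`Y ⊗ X 1 ⊗ Z, …, Y ⊗ X N ⊗ Z` of subspaces of `Y ⊗ W ⊗ Z` is distributive, then the collection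
`X 1, …, X N` of subspaces of `W` is distributive.
Here `Y ⊗ P ⊗ Z` denotes the range of `id_Y ⊗ (inclusion of P) ⊗ id_Z`. -/
theorem middle_distributive_of_distributive
    {k Y W Z : Type*} [Field k] [AddCommGroup Y] [Module k Y]
    [AddCommGroup W] [Module k W] [AddCommGroup Z] [Module k Z]
    [Nontrivial Y] [Nontrivial W] [Nontrivial Z]
    (N : ℕ) (X : Fin N → Submodule k W)
    (hX : IsDistributiveCollection
      (Set.range fun i : Fin N =>
        LinearMap.range (TensorProduct.map (LinearMap.id : Y →ₗ[k] Y)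
          (TensorProduct.map (X i).subtype (LinearMap.id : Z →ₗ[k] Z))))) :
    IsDistributiveCollection (Set.range X) := by
  have key : ∀ a ∈ latticeClosure (Set.range X), midF Y Z a ∈ latticeClosure
      (Set.range fun i : Fin N =>
        LinearMap.range (TensorProduct.map (LinearMap.id : Y →ₗ[k] Y)
          (TensorProduct.map (X i).subtype (LinearMap.id : Z →ₗ[k] Z)))) := by
    intro a ha
    induction ha using latticeClosure_sup_inf_induction with
    | mem a h =>
      obtain ⟨i, rfl⟩ := h
      exact subset_latticeClosure ⟨i, rfl⟩
    | sup a _ b _ iha ihb =>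
      rw [midF_sup]
      exact isSublattice_latticeClosure.supClosed iha ihb
    | inf a _ b _ iha ihb =>
      rw [midF_inf]
      exact isSublattice_latticeClosure.infClosed iha ihb
  intro a ha b hb c hc
  apply midF_inj (Y := Y) (Z := Z)
  simp only [midF_inf, midF_sup]
  exact hX _ (key a ha) _ (key b hb) _ (key c hc)
end
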